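/- arXiv:2512.00153 — 2 statements merged into one kernel-verified Lean document; each statement's English description precedes it below -/
import Mathlib

section
/- There exists a family B of 2λ+1 (s,t)-flows of G such that: (1) for every edge e ∈ E, B contains a flow f with f(e) = 0 whose value equals the maximum (s,t)-flow value of G − e; and (2) any two flows f, f' ∈ B disagree on at most 6n edges, i.e., |{e ∈ E : f(e) ≠ f'(e)}| ≤ 6n. -/
open Finset

/-- A finite directed multigraph on vertex type `V` with edge type `E`:
each edge `e` has a source `src e` and a target `tgt e`. -/
structure Digraph' (V E : Type) where
  src : E → V
  tgt : E → V

namespace Digraph'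

variable {V E : Type} [Fintype V] [DecidableEq V] [Fintype E] [DecidableEq E]

/-- `h : E → ℕ` satisfies flow conservation at every vertex other than `s` and `t`:
the sum over incoming edges equals the sum over outgoing edges. -/
def Conserves (G : Digraph' V E) (s t : V) (h : E → ℕ) : Prop :=
  ∀ v : V, v ≠ s → v ≠ t →
    ∑ e ∈ univ.filter (fun e => G.tgt e = v), h e =
      ∑ e ∈ univ.filter (fun e => G.src e = v), h e

/-- The value of `h`: the net flow out of `s`. -/
def flowValue (G : Digraph' V E) (s : V) (h : E → ℕ) : ℤ :=
  (∑ e ∈ univ.filter (fun e => G.src e = s), (h e : ℤ)) -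
    ∑ e ∈ univ.filter (fun e => G.tgt e = s), (h e : ℤ)

/-- An `(s,t)`-flow of a unit-capacity digraph: a `{0,1}`-valued function on edges
satisfying flow conservation at every vertex other than `s` and `t`. -/
def IsFlow (G : Digraph' V E) (s t : V) (f : E → ℕ) : Prop :=
  (∀ e, f e ≤ 1) ∧ G.Conserves s t f

/-- One step along an edge not belonging to `F`. -/
def stepAvoid (G : Digraph' V E) (F : Finset E) (u v : V) : Prop :=
  ∃ e, e ∉ F ∧ G.src e = u ∧ G.tgt e = v

/-- Reachability by a directed path using no edge of `F`. -/
def ReachAvoid (G : Digraph' V E) (F : Finset E) : V → V → Prop :=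
  Relation.ReflTransGen (G.stepAvoid F)

/-- `C` is an `(s,t)`-cut: after deleting the edges of `C` there is no directed
path from `s` to `t`. -/
def IsCut (G : Digraph' V E) (s t : V) (C : Finset E) : Prop :=
  ¬ G.ReachAvoid C s t

/-- An `(s,t)`-min-cut: an `(s,t)`-cut of minimum cardinality. -/
def IsMinCut (G : Digraph' V E) (s t : V) (C : Finset E) : Prop :=
  G.IsCut s t C ∧ ∀ C' : Finset E, G.IsCut s t C' → C.card ≤ C'.card

/-- A minimal `(s,t)`-cut: no proper subset of it is an `(s,t)`-cut. -/
def IsMinimalCut (G : Digraph' V E) (s t : V) (C : Finset E) : Prop :=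
  G.IsCut s t C ∧ ∀ C' : Finset E, C' ⊂ C → ¬ G.IsCut s t C'

/-- An edge is critical if it belongs to some `(s,t)`-min-cut. -/
def Critical (G : Digraph' V E) (s t : V) (e : E) : Prop :=
  ∃ C : Finset E, G.IsMinCut s t C ∧ e ∈ C

/-- `m` is the maximum `(s,t)`-flow value of `G − F`, i.e. the largest value of an
`(s,t)`-flow of `G` vanishing on every edge of `F`. -/
def IsMaxFlowValue (G : Digraph' V E) (s t : V) (F : Finset E) (m : ℤ) : Prop :=
  (∃ f, G.IsFlow s t f ∧ (∀ e ∈ F, f e = 0) ∧ G.flowValue s f = m) ∧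
    ∀ f, G.IsFlow s t f → (∀ e ∈ F, f e = 0) → G.flowValue s f ≤ m

/-- The residual graph `G_f` of a `{0,1}`-flow `f`: each edge with `f e = 1`
is reversed, each edge with `f e = 0` is kept as is. -/
def residual (G : Digraph' V E) (f : E → ℕ) : Digraph' V E where
  src e := if f e = 1 then G.tgt e else G.src e
  tgt e := if f e = 1 then G.src e else G.tgt e

end Digraph'

section FlowTools
set_option linter.unusedSectionVars false
variable {V A : Type} [Fintype V] [DecidableEq V] [Fintype A] [DecidableEq A]

/-- signed incidence of an edge at a vertex -/
def inc5 (src tgt : A → V) (e : A) (v : V) : ℤ :=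
  (if src e = v then 1 else 0) - (if tgt e = v then 1 else 0)

/-- circulation -/
def Circ5 (src tgt : A → V) (x : A → ℤ) : Prop := ∀ v, ∑ e, x e * inc5 src tgt e v = 0

theorem Circ5.add {src tgt : A → V} {x y : A → ℤ} (hx : Circ5 src tgt x) (hy : Circ5 src tgt y) :
    Circ5 src tgt (fun e => x e + y e) := by
  intro v
  simp only [add_mul, sum_add_distrib, hx v, hy v, add_zero]

theorem Circ5.sub {src tgt : A → V} {x y : A → ℤ} (hx : Circ5 src tgt x) (hy : Circ5 src tgt y) :
    Circ5 src tgt (fun e => x e - y e) := by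
  intro v
  simp only [sub_mul, sum_sub_distrib, hx v, hy v, sub_zero]

theorem Circ5.smul {src tgt : A → V} {x : A → ℤ} (k : ℤ) (hx : Circ5 src tgt x) :
    Circ5 src tgt (fun e => k * x e) := by
  intro v
  simp only [mul_assoc, ← mul_sum, hx v, mul_zero]

theorem Circ5.sum {src tgt : A → V} {ι : Type} (I : Finset ι) {x : ι → A → ℤ}
    (hx : ∀ i ∈ I, Circ5 src tgt (x i)) :
    Circ5 src tgt (fun e => ∑ i ∈ I, x i e) := by
  intro v
  simp only [sum_mul]
  rw [sum_comm]
  exact sum_eq_zero fun i hi => hx i hi v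

theorem Circ5.zero {src tgt : A → V} : Circ5 src tgt (fun _ => 0) := by
  intro v; simp

theorem cyc5 (src tgt : A → V) (S : Finset A) (hS : S.Nonempty)
    (h : ∀ e ∈ S, ∃ e' ∈ S, src e' = tgt e) :
    ∃ C ⊆ S, C.Nonempty ∧ C.card ≤ Fintype.card V ∧ ∀ v, ∑ e ∈ C, inc5 src tgt e v = 0 := by
  have hA : Nonempty A := ⟨hS.choose⟩
  have h1 : ∀ v, v ∈ S.image src → ∃ e, e ∈ S ∧ src e = v := by
    intro v hv
    simpa using hv
  choose! o ho1 ho2 using h1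
  have h2 : ∀ v ∈ S.image src, tgt (o v) ∈ S.image src := by
    intro v hv
    obtain ⟨e', he', h'⟩ := h _ (ho1 v hv)
    exact mem_image.2 ⟨e', he', h'⟩
  obtain ⟨P, hP, hmin⟩ := exists_min_image
    ((S.image src).powerset.filter (fun P => P.Nonempty ∧ ∀ v ∈ P, tgt (o v) ∈ P)) card
    ⟨S.image src, by simp only [mem_filter, mem_powerset]; exact ⟨Subset.rfl, hS.image _, h2⟩⟩
  simp only [mem_filter, mem_powerset] at hP hmin
  obtain ⟨hPS, hPn, hPc⟩ := hP
  have hsub : P.image (fun v => tgt (o v)) ⊆ P := by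
    intro u hu
    obtain ⟨v, hv, rfl⟩ := mem_image.1 hu
    exact hPc v hv
  have hcard := hmin (P.image (fun v => tgt (o v)))
    ⟨hsub.trans hPS, hPn.image _, fun v hv => mem_image_of_mem _ (hsub hv)⟩
  have heq : P.image (fun v => tgt (o v)) = P := eq_of_subset_of_card_le hsub hcard
  have hinj : Set.InjOn (fun v => tgt (o v)) (P : Set V) := by
    apply card_image_iff.1
    rw [heq]
  have hoinj : Set.InjOn o (P : Set V) := by
    intro a ha b hb hab
    rw [← ho2 a (hPS ha), ← ho2 b (hPS hb), hab]
  refine ⟨P.image o, ?_, hPn.image _, ?_, ?_⟩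
  · intro e he
    obtain ⟨v, hv, rfl⟩ := mem_image.1 he
    exact ho1 v (hPS hv)
  · exact card_image_le.trans (card_le_univ P)
  · intro v
    rw [sum_image hoinj]
    unfold inc5
    rw [sum_sub_distrib, sub_eq_zero]
    have e1 : ∑ x ∈ P, (if tgt (o x) = v then (1:ℤ) else 0)
        = ∑ u ∈ P.image (fun v => tgt (o v)), (if u = v then (1:ℤ) else 0) := by
      rw [sum_image hinj]
    rw [e1, heq]
    apply sum_congr rfl
    intro x hx
    rw [ho2 x (hPS hx)]

/-- sign conformality -/
def Conf5 (a b : ℤ) : Prop := a = 0 ∨ (a = 1 ∧ 0 < b) ∨ (a = -1 ∧ b < 0)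

theorem signed5 (src tgt : A → V) (δ : A → ℤ) (hδ : Circ5 src tgt δ) (hne : ∃ e, δ e ≠ 0) :
    ∃ γ : A → ℤ, Circ5 src tgt γ ∧ (∀ e, Conf5 (γ e) (δ e)) ∧
      (univ.filter (fun e => γ e ≠ 0)).card ≤ Fintype.card V ∧ ∃ e, γ e ≠ 0 := by
  set a : A → V := fun e => if 0 < δ e then src e else tgt e with ha
  set b : A → V := fun e => if 0 < δ e then tgt e else src e with hb
  have key : ∀ e v, δ e * inc5 src tgt e v = |δ e| * inc5 a b e v := by
    intro e v
    by_cases h : 0 < δ e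
    · simp [inc5, ha, hb, h, abs_of_pos h]
    · simp only [inc5, ha, hb, h, abs_of_nonpos (not_lt.1 h), if_false]
      ring
  obtain ⟨C, hCS, hCn, hCc, hC⟩ := cyc5 a b (univ.filter (fun e => δ e ≠ 0))
    (by obtain ⟨e, he⟩ := hne; exact ⟨e, by simpa using he⟩) (by
      intro e he
      by_contra hcon
      push Not at hcon
      have := hδ (b e)
      simp only [key] at this
      have hneg : ∀ e' ∈ univ, |δ e'| * inc5 a b e' (b e) ≤ 0 := by
        intro e' _
        by_cases h0 : δ e' = 0
        · simp [h0]
        · have := hcon e' (by simpa using h0)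
          apply mul_nonpos_of_nonneg_of_nonpos (abs_nonneg _)
          unfold inc5
          rw [if_neg this]
          split_ifs <;> simp
      have h3 := (sum_eq_zero_iff_of_nonpos hneg).1 this e (mem_univ _)
      have h4 := hcon e he
      have h5 : δ e ≠ 0 := by simpa using he
      unfold inc5 at h3
      rw [if_neg h4, if_pos rfl] at h3
      simp at h3
      exact h5 h3)
  refine ⟨fun e => if e ∈ C then (if 0 < δ e then 1 else -1) else 0, ?_, ?_, ?_, ?_⟩
  · intro v
    refine Eq.trans ?_ (hC v)
    simp only [ite_mul, zero_mul]
    rw [sum_ite_mem, univ_inter]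
    apply sum_congr rfl
    intro e _
    by_cases h : 0 < δ e
    · simp [inc5, ha, hb, h]
    · simp [inc5, ha, hb, h]
  · intro e
    by_cases he : e ∈ C
    · have := hCS he
      have h5 : δ e ≠ 0 := by simpa using this
      by_cases h : 0 < δ e
      · simp [Conf5, he, h]
      · have : δ e < 0 := by omega
        simp [Conf5, he, h, this]
    · simp [Conf5, he]
  · refine (card_le_card ?_).trans hCc
    intro e he
    by_contra h
    simp [h] at he
  · obtain ⟨e, he⟩ := hCn
    refine ⟨e, ?_⟩
    simp only [he, if_true]
    split_ifs <;> simp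

theorem toolW5 (src tgt : A → V) (w : A → ℤ) : ∀ (m : ℕ) (δ : A → ℤ), ∑ e, (δ e).natAbs ≤ m →
    Circ5 src tgt δ → ∑ e, w e * δ e < 0 →
    ∃ γ : A → ℤ, Circ5 src tgt γ ∧ (∀ e, Conf5 (γ e) (δ e)) ∧
      (univ.filter (fun e => γ e ≠ 0)).card ≤ Fintype.card V ∧ ∑ e, w e * γ e < 0 := by
  intro m
  induction m with
  | zero =>
    intro δ hm _ hw
    exfalso
    have : ∀ e, δ e = 0 := by
      intro e
      have := (sum_eq_zero_iff.1 (Nat.le_zero.1 hm)) e (mem_univ _)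
      simpa using this
    simp [this] at hw
  | succ m ih =>
    intro δ hm hδ hw
    have hne : ∃ e, δ e ≠ 0 := by
      by_contra h
      push Not at h
      simp [h] at hw
    obtain ⟨γ, h1, h2, h3, e0, h4⟩ := signed5 src tgt δ hδ hne
    by_cases hγ : ∑ e, w e * γ e < 0
    · exact ⟨γ, h1, h2, h3, hγ⟩
    have hlt : ∑ e, (δ e - γ e).natAbs < ∑ e, (δ e).natAbs := by
      apply sum_lt_sum
      · intro e _
        rcases h2 e with h | ⟨h, h'⟩ | ⟨h, h'⟩ <;> omega
      · refine ⟨e0, mem_univ _, ?_⟩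
        rcases h2 e0 with h | ⟨h, h'⟩ | ⟨h, h'⟩ <;> omega
    obtain ⟨γ', g1, g2, g3, g4⟩ := ih (fun e => δ e - γ e) (by omega) (hδ.sub h1) (by
      simp only [mul_sub, sum_sub_distrib]; omega)
    refine ⟨γ', g1, ?_, g3, g4⟩
    intro e
    have := g2 e
    have := h2 e
    unfold Conf5 at *
    omega

theorem tool5 (src tgt : A → V) (w : A → ℤ) (δ : A → ℤ)
    (h : Circ5 src tgt δ) (hw : ∑ e, w e * δ e < 0) :
    ∃ γ : A → ℤ, Circ5 src tgt γ ∧ (∀ e, Conf5 (γ e) (δ e)) ∧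
      (univ.filter (fun e => γ e ≠ 0)).card ≤ Fintype.card V ∧ ∑ e, w e * γ e < 0 :=
  toolW5 src tgt w _ δ le_rfl h hw

/-- conformal cycle through a given edge -/
theorem thru5 (src tgt : A → V) (r : A) (δ : A → ℤ)
    (h : Circ5 src tgt δ) (hr : δ r ≠ 0) :
    ∃ γ : A → ℤ, Circ5 src tgt γ ∧ (∀ e, Conf5 (γ e) (δ e)) ∧
      (univ.filter (fun e => γ e ≠ 0)).card ≤ Fintype.card V ∧ γ r ≠ 0 := by
  have hs : ∀ x : A → ℤ, ∑ e, (if e = r then -(δ r) else 0) * x e = -(δ r) * x r := by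
    intro x; simp
  obtain ⟨γ, h1, h2, h3, h4⟩ := tool5 src tgt (fun e => if e = r then -(δ r) else 0) δ h (by
    rw [hs]; have := mul_self_pos.2 hr; linarith)
  refine ⟨γ, h1, h2, h3, ?_⟩
  intro h0
  rw [hs, h0] at h4
  simp at h4

/-- path decomposition -/
theorem paths5 (src tgt : A → V) (r : A) : ∀ (k : ℕ) (x : A → ℤ), Circ5 src tgt x →
    (∀ e, 0 ≤ x e) → x r = k → ∃ P : Fin k → A → ℤ, (∀ i, Circ5 src tgt (P i)) ∧
      (∀ i e, 0 ≤ P i e ∧ P i e ≤ 1) ∧ (∀ i, P i r = 1) ∧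
      (∀ i, (univ.filter (fun e => P i e ≠ 0)).card ≤ Fintype.card V) ∧
      ∀ e, ∑ i, P i e ≤ x e := by
  intro k
  induction k with
  | zero =>
    intro x hx h0 hr
    exact ⟨fun i => i.elim0, fun i => i.elim0, fun i => i.elim0, fun i => i.elim0,
      fun i => i.elim0, by simpa using h0⟩
  | succ k ih =>
    intro x hx h0 hr
    obtain ⟨γ, h1, h2, h3, h4⟩ := thru5 src tgt r x hx (by rw [hr]; push_cast; omega)
    have hb : ∀ e, 0 ≤ γ e ∧ γ e ≤ 1 ∧ γ e ≤ x e := by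
      intro e
      have := h0 e
      rcases h2 e with h | ⟨h, h'⟩ | ⟨h, h'⟩ <;> omega
    have hγr : γ r = 1 := by
      have := hb r
      omega
    obtain ⟨P, p1, p2, p3, p4, p5⟩ := ih (fun e => x e - γ e) (hx.sub h1)
      (fun e => by have := hb e; omega) (by push_cast at hr; omega)
    refine ⟨Fin.cons γ P, ?_, ?_, ?_, ?_, ?_⟩
    · intro i; refine Fin.cases ?_ ?_ i
      · exact h1
      · exact p1
    · intro i; refine Fin.cases ?_ ?_ i
      · intro e; exact ⟨(hb e).1, (hb e).2.1⟩
      · exact p2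
    · intro i; refine Fin.cases ?_ ?_ i
      · exact hγr
      · exact p3
    · intro i; refine Fin.cases ?_ ?_ i
      · exact h3
      · exact p4
    · intro e
      rw [Fin.sum_univ_succ]
      simp only [Fin.cons_zero, Fin.cons_succ]
      have := p5 e
      omega

/-- integral rounding of x / k into the box [l,u] -/
theorem round5 (src tgt : A → V) (k : ℕ) (hk : 0 < k) (x l u : A → ℤ) (hx : Circ5 src tgt x)
    (hl : ∀ e, k * l e ≤ x e) (hu : ∀ e, x e ≤ k * u e) (hlu : ∀ e, l e ≤ u e) :
    ∃ f, Circ5 src tgt f ∧ ∀ e, l e ≤ f e ∧ f e ≤ u e := by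
  have main : ∀ (m : ℕ) (f : A → ℤ), Circ5 src tgt f →
      ∑ e, ((l e - f e).toNat + (f e - u e).toNat) ≤ m →
      ∃ f, Circ5 src tgt f ∧ ∀ e, l e ≤ f e ∧ f e ≤ u e := by
    intro m
    induction m with
    | zero =>
      intro f hf hm
      refine ⟨f, hf, fun e => ?_⟩
      have := (sum_eq_zero_iff.1 (Nat.le_zero.1 hm)) e (mem_univ _)
      omega
    | succ m ih =>
      intro f hf hm
      by_cases hall : ∀ e, l e ≤ f e ∧ f e ≤ u e
      · exact ⟨f, hf, hall⟩
      push Not at hall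
      obtain ⟨e0, he0⟩ := hall
      have hk' : (0:ℤ) < k := by exact_mod_cast hk
      have hpos : ∀ e, 0 < x e - k * f e → f e < u e := by
        intro e he
        have := hu e
        by_contra hc
        push Not at hc
        have := mul_le_mul_of_nonneg_left hc hk'.le
        linarith
      have hneg : ∀ e, x e - k * f e < 0 → l e < f e := by
        intro e he
        have := hl e
        by_contra hc
        push Not at hc
        have := mul_le_mul_of_nonneg_left hc hk'.le
        linarith
      have hne : x e0 - k * f e0 ≠ 0 := by
        intro h0
        have h1 := hl e0
        have h2 := hu e0
        have h3 : x e0 = k * f e0 := by linarith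
        rw [h3] at h1 h2
        have h4 := le_of_mul_le_mul_left h1 hk'
        have h5 := le_of_mul_le_mul_left h2 hk'
        exact absurd (he0 h4) (not_lt.2 h5)
      obtain ⟨γ, h1, h2, h3, h4⟩ := thru5 src tgt e0 (fun e => x e - k * f e)
        (hx.sub (hf.smul k)) hne
      refine ih (fun e => f e + γ e) (hf.add h1) ?_
      have : ∑ e, ((l e - (f e + γ e)).toNat + ((f e + γ e) - u e).toNat)
          < ∑ e, ((l e - f e).toNat + (f e - u e).toNat) := by
        apply sum_lt_sum
        · intro e _
          have := hpos e
          have := hneg e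
          have := hlu e
          rcases h2 e with h | ⟨h, h'⟩ | ⟨h, h'⟩ 
          · omega
          · have := hpos e h'
            omega
          · have := hneg e h'
            omega
        · refine ⟨e0, mem_univ _, ?_⟩
          have := hlu e0
          rcases h2 e0 with h | ⟨h, h'⟩ | ⟨h, h'⟩ 
          · omega
          · have := hpos e0 h'
            omega
          · have := hneg e0 h'
            omega
      omega
  exact main _ (fun _ => 0) Circ5.zero le_rfl

theorem decomp5 (src tgt : A → V) (r : A) (q : ℤ) : ∀ (k : ℕ) (x : A → ℤ), Circ5 src tgt x →
    (∀ e, e ≠ r → 0 ≤ x e ∧ x e ≤ k) → x r = k * q →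
    ∃ F : Fin k → A → ℤ, (∀ i, Circ5 src tgt (F i)) ∧
      (∀ i e, e ≠ r → 0 ≤ F i e ∧ F i e ≤ 1) ∧ (∀ i, F i r = q) ∧
      ∀ e, ∑ i, F i e = x e := by
  intro k
  induction k with
  | zero =>
    intro x hx h0 hr
    refine ⟨fun i => i.elim0, fun i => i.elim0, fun i => i.elim0, fun i => i.elim0, ?_⟩
    intro e
    by_cases he : e = r
    · subst he; simp [hr]
    · have := h0 e he
      simp; push_cast at this; omega
  | succ k ih =>
    intro x hx h0 hr
    obtain ⟨f, f1, f2⟩ := round5 src tgt (k+1) (Nat.succ_pos k) x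
      (fun e => if e = r then q else if x e = k + 1 then 1 else 0)
      (fun e => if e = r then q else if x e = 0 then 0 else 1) hx (by
        intro e
        by_cases he : e = r
        · subst he; simp [hr]
        · have := h0 e he
          simp only [he, if_false]
          push_cast at *
          split_ifs <;> omega) (by
        intro e
        by_cases he : e = r
        · subst he; simp [hr]
        · have := h0 e he
          simp only [he, if_false]
          push_cast at *
          split_ifs <;> omega) (by
        intro e
        by_cases he : e = r
        · simp [he]
        · simp only [he, if_false]
          split_ifs <;> omega)
    obtain ⟨F, p1, p2, p3, p4⟩ := ih (fun e => x e - f e) (hx.sub f1) (by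
      intro e he
      have h := h0 e he
      have := f2 e
      simp only [he, if_false] at this
      push_cast at h
      split_ifs at this <;> omega) (by
      have := f2 r
      simp only [if_true] at this
      push_cast at hr
      have : f r = q := le_antisymm this.2 this.1
      rw [hr, this]; ring)
    refine ⟨Fin.cons f F, ?_, ?_, ?_, ?_⟩
    · intro i; refine Fin.cases ?_ ?_ i
      · exact f1
      · exact p1
    · intro i; refine Fin.cases ?_ ?_ i
      · intro e he
        have := f2 e
        simp only [he, if_false] at this
        simp only [Fin.cons_zero]
        split_ifs at this <;> omega
      · exact p2
    · intro i; refine Fin.cases ?_ ?_ i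
      · have := f2 r
        simp only [if_true] at this
        exact le_antisymm this.2 this.1
      · exact p3
    · intro e
      rw [Fin.sum_univ_succ]
      simp only [Fin.cons_zero, Fin.cons_succ]
      rw [p4]; ring

theorem indep5 (src tgt : A → V) (S : Finset A) (hc : Fintype.card V < S.card) :
    ∃ δ : A → ℤ, Circ5 src tgt δ ∧ (∀ e, e ∉ S → δ e = 0) ∧ ∃ e, δ e ≠ 0 := by
  have hn : ¬ LinearIndependent ℤ (fun e : S => (fun v => inc5 src tgt e.1 v : V → ℤ)) := by
    intro h
    have := h.fintype_card_le_finrank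
    simp at this
    omega
  obtain ⟨g, hg, i, hi⟩ := Fintype.not_linearIndependent_iff.1 hn
  refine ⟨fun e => if h : e ∈ S then g ⟨e, h⟩ else 0, ?_, ?_, ?_⟩
  · intro v
    have h1 := congrFun hg v
    simp only [Finset.sum_apply, Pi.smul_apply, smul_eq_mul, Pi.zero_apply] at h1
    rw [← sum_subset (subset_univ S), ← sum_coe_sort S]
    · refine Eq.trans ?_ h1
      apply sum_congr rfl
      intro x _
      simp
    · intro x _ hx
      simp [hx]
  · intro e he; simp [he]
  · exact ⟨i.1, by simpa using hi⟩

/-- feasible circulation -/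
def Feas5 (src tgt : A → V) (r : A) (c : A → ℤ) (k : ℕ) (h : A → ℤ) : Prop :=
  Circ5 src tgt h ∧ (∀ e, 0 ≤ h e ∧ h e ≤ c e) ∧ h r = k

theorem ext5 (src tgt : A → V) (r : A) (c : A → ℤ) (k : ℕ) (hcr : c r = k)
    (hex : ∃ h, Feas5 src tgt r c k h) :
    ∃ h, Feas5 src tgt r c k h ∧ ∑ e, h e ≤ k * Fintype.card V ∧
      (univ.filter (fun e => 0 < h e ∧ h e < c e)).card ≤ Fintype.card V := by
  set K : ℤ := ∑ e, c e ^ 2 with hK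
  have hfin : {h | Feas5 src tgt r c k h}.Finite := by
    apply (Set.finite_Icc (0 : A → ℤ) c).subset
    rintro h ⟨_, h2, _⟩
    exact ⟨fun e => (h2 e).1, fun e => (h2 e).2⟩
  obtain ⟨h, hf, hmin⟩ := Set.exists_min_image _
    (fun h : A → ℤ => (K + 1) * ∑ e, h e - ∑ e, h e ^ 2) hfin hex
  have hf' : Feas5 src tgt r c k h := hf
  obtain ⟨h1, h2, h3⟩ := hf'
  have hK0 : 0 ≤ K := sum_nonneg fun e _ => sq_nonneg _
  have hhK : ∑ e, h e ^ 2 ≤ K := by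
    apply sum_le_sum
    intro e _
    have := h2 e
    exact pow_le_pow_left₀ this.1 this.2 2
  refine ⟨h, hf, ?_, ?_⟩
  · obtain ⟨P, p1, p2, p3, p4, p5⟩ := paths5 src tgt r k h h1 (fun e => (h2 e).1) h3
    have hy : Feas5 src tgt r c k (fun e => ∑ i, P i e) := by
      refine ⟨Circ5.sum _ fun i _ => p1 i, fun e => ⟨sum_nonneg fun i _ => (p2 i e).1,
        (p5 e).trans (h2 e).2⟩, ?_⟩
      simp [p3]
    have hle := hmin _ hy
    have hsq : 0 ≤ ∑ e, (∑ i, P i e) ^ 2 := sum_nonneg fun e _ => sq_nonneg _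
    have hPs : ∑ e, ∑ i, P i e ≤ k * Fintype.card V := by
      rw [sum_comm]
      have : ∀ i ∈ (univ : Finset (Fin k)), ∑ e, P i e ≤ Fintype.card V := by
        intro i _
        have h4 : ∑ e, P i e ≤ ((univ.filter (fun e => P i e ≠ 0)).card : ℤ) := by
          rw [card_filter]
          push_cast
          apply sum_le_sum
          intro e _
          have := p2 i e
          split_ifs <;> omega
        have := p4 i
        omega
      refine (sum_le_sum this).trans ?_
      simp
    by_contra hcon
    have : ∑ e, ∑ i, P i e + 1 ≤ ∑ e, h e := by omega
    nlinarith
  · by_contra hcon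
    push Not at hcon
    obtain ⟨δ, d1, d2, e0, d3⟩ := indep5 src tgt _ hcon
    obtain ⟨γ, g1, g2, g3, g4⟩ := thru5 src tgt e0 δ d1 d3
    have hsupp : ∀ e, γ e ≠ 0 → 0 < h e ∧ h e < c e := by
      intro e he
      by_contra hn
      have := d2 e (by simpa using hn)
      rcases g2 e with h | ⟨h, h'⟩ | ⟨h, h'⟩ <;> omega
    have habs : ∀ e, -1 ≤ γ e ∧ γ e ≤ 1 := by
      intro e
      rcases g2 e with h | ⟨h, h'⟩ | ⟨h, h'⟩ <;> omega
    have hγr : γ r = 0 := by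
      by_contra hn
      have := hsupp r hn
      omega
    have ha : Feas5 src tgt r c k (fun e => h e + γ e) := by
      refine ⟨h1.add g1, fun e => ?_, by simp only [hγr, h3, add_zero]⟩
      have := hsupp e
      have := habs e
      have := h2 e
      by_cases h0 : γ e = 0
      · simp only [h0]; omega
      · have := hsupp e h0
        constructor <;> dsimp only <;> omega
    have hb : Feas5 src tgt r c k (fun e => h e - γ e) := by
      refine ⟨h1.sub g1, fun e => ?_, by simp only [hγr, h3, sub_zero]⟩
      have := hsupp e
      have := habs e
      have := h2 e
      by_cases h0 : γ e = 0
      · simp only [h0]; omega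
      · have := hsupp e h0
        constructor <;> dsimp only <;> omega
    have ma := hmin _ ha
    have mb := hmin _ hb
    simp only [sum_add_distrib, sum_sub_distrib] at ma mb
    have hsum : ∑ e, (h e + γ e) ^ 2 + ∑ e, (h e - γ e) ^ 2
        = 2 * ∑ e, h e ^ 2 + 2 * ∑ e, γ e ^ 2 := by
      rw [mul_sum, mul_sum, ← sum_add_distrib, ← sum_add_distrib]
      apply sum_congr rfl
      intro e _
      ring
    have hpos : 0 < ∑ e, γ e ^ 2 :=
      sum_pos' (fun e _ => sq_nonneg _) ⟨e0, mem_univ _, by positivity⟩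
    nlinarith

theorem core5 (src tgt : A → V) (r : A) (lam : ℕ) (N : A → Prop) [DecidablePred N]
    (hex : ∃ h, Feas5 src tgt r (fun e => if e = r then lam * (lam + 1) else
      if N e then lam else lam + 1) (lam * (lam + 1)) h) :
    ∃ F : Fin (lam + 1) → A → ℤ, (∀ i, Circ5 src tgt (F i)) ∧
      (∀ i e, e ≠ r → 0 ≤ F i e ∧ F i e ≤ 1) ∧ (∀ i, F i r = lam) ∧
      (∀ e, e ≠ r → N e → ∃ i, F i e = 0) ∧
      ∀ i j, (univ.filter (fun e => F i e ≠ F j e)).card ≤ 5 * Fintype.card V := by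
  obtain ⟨h, ⟨h1, h2, h3⟩, h4, h5⟩ := ext5 src tgt r _ _ (by simp) hex
  set n := Fintype.card V with hn
  have hN : ∀ e, e ≠ r → N e → h e ≤ lam := by
    intro e he hNe
    have := (h2 e).2
    simpa [he, hNe] using this
  have hC : ∀ e, e ≠ r → 0 ≤ h e ∧ h e ≤ (lam + 1 : ℕ) := by
    intro e he
    have := h2 e
    simp only [he, if_false] at this
    push_cast
    split_ifs at this <;> omega
  set T : Finset A := univ.filter (fun e => e ≠ r ∧ N e ∧ h e = lam ∧ 0 < lam) with hT
  have hTc : (T.card : ℤ) ≤ (lam + 1) * n := by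
    rcases Nat.eq_zero_or_pos lam with h0 | h0
    · have : T = ∅ := by simp [hT, h0]
      rw [this]; simp only [card_empty]; positivity
    · have hs : ∑ e ∈ T, h e ≤ ∑ e, h e :=
        sum_le_sum_of_subset_of_nonneg (subset_univ _) fun e _ _ => (h2 e).1
      have hs2 : ∑ e ∈ T, h e = T.card * lam := by
        rw [sum_congr rfl (g := fun _ => (lam : ℤ))]
        · simp
        · intro e he
          simp only [hT, mem_filter] at he
          exact he.2.2.2.1
      rw [hs2] at hs
      have := hs.trans h4
      push_cast at this
      have h0' : (0:ℤ) < lam := by exact_mod_cast h0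
      nlinarith
  set Dec : Set (Fin (lam + 1) → A → ℤ) := {F | (∀ i, Circ5 src tgt (F i)) ∧
      (∀ i e, e ≠ r → 0 ≤ F i e ∧ F i e ≤ 1) ∧ (∀ i, F i r = lam) ∧
      ∀ e, ∑ i, F i e = h e} with hDec
  have hfin : Dec.Finite := by
    apply (Set.finite_Icc (fun _ _ => 0 : Fin (lam + 1) → A → ℤ)
      (fun _ _ => (lam : ℤ) + 1)).subset
    rintro F ⟨_, f2, f3, _⟩
    constructor
    · intro i e
      by_cases he : e = r
      · subst he; simp [f3]
      · exact (f2 i e he).1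
    · intro i e
      by_cases he : e = r
      · subst he; simp [f3]
      · have := f2 i e he
        simp only
        omega
  have hne : Dec.Nonempty := decomp5 src tgt r lam (lam + 1) h h1 hC (by rw [h3]; push_cast; ring)
  obtain ⟨F, hF, hmin⟩ := Set.exists_min_image Dec
    (fun F => ∑ i, (∑ e ∈ T, (1 - F i e)) ^ 2) hfin hne
  have hF' := hF
  obtain ⟨f1, f2, f3, f4⟩ := hF'
  have hTr : ∀ e ∈ T, e ≠ r := by
    intro e he
    simp only [hT, mem_filter] at he
    exact he.2.1
  -- balance
  have hbal : ∀ i j, ∑ e ∈ T, (1 - F i e) ≤ ∑ e ∈ T, (1 - F j e) + n := by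
    intro i j
    by_contra hcon
    push Not at hcon
    have hij : i ≠ j := by
      rintro rfl
      have : (0:ℤ) ≤ n := by positivity
      omega
    obtain ⟨γ, g1, g2, g3, g4⟩ := tool5 src tgt (fun e => if e ∈ T then 1 else 0)
      (fun e => F i e - F j e) ((f1 i).sub (f1 j)) (by
        simp only [ite_mul, one_mul, zero_mul]
        rw [sum_ite_mem, univ_inter]
        simp only [sum_sub_distrib] at hcon ⊢
        have : (0:ℤ) ≤ n := by positivity
        omega)
    simp only [ite_mul, one_mul, zero_mul] at g4
    rw [sum_ite_mem, univ_inter] at g4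
    have hγr : γ r = 0 := by
      have := g2 r
      simp only [Conf5, f3] at this
      omega
    have hγlow : -(n : ℤ) ≤ ∑ e ∈ T, γ e := by
      have ha : ∑ e ∈ T, (-γ e) ≤ ∑ e, (if γ e ≠ 0 then (1:ℤ) else 0) := by
        refine (sum_le_sum (g := fun e => if γ e ≠ 0 then (1:ℤ) else 0) ?_).trans
          (sum_le_sum_of_subset_of_nonneg (subset_univ _) ?_)
        · intro e _
          rcases g2 e with h | ⟨h, h'⟩ | ⟨h, h'⟩ <;> simp [h]
        · intro e _ _
          split_ifs <;> simp
      rw [sum_neg_distrib] at ha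
      rw [card_filter] at g3
      have : ((∑ e, if γ e ≠ 0 then 1 else 0 : ℕ) : ℤ) ≤ n := by exact_mod_cast g3
      push_cast at this
      linarith
    set F' : Fin (lam + 1) → A → ℤ := fun l e =>
      F l e + (if l = j then γ e else 0) - (if l = i then γ e else 0) with hF'
    have hFi : ∀ e, F' i e = F i e - γ e := by intro e; simp [hF', hij]
    have hFj : ∀ e, F' j e = F j e + γ e := by intro e; simp [hF', hij.symm]
    have hFl : ∀ l, l ≠ i → l ≠ j → F' l = F l := by
      intro l hli hlj; funext e; simp [hF', hli, hlj]
    have hmem : F' ∈ Dec := by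
      refine ⟨?_, ?_, ?_, ?_⟩
      · intro l
        by_cases hli : l = i
        · subst hli
          rw [show F' l = _ from funext hFi]
          exact (f1 l).sub g1
        · by_cases hlj : l = j
          · subst hlj
            rw [show F' l = _ from funext hFj]
            exact (f1 l).add g1
          · rw [hFl l hli hlj]; exact f1 l
      · intro l e he
        have hi := f2 i e he
        have hj := f2 j e he
        have hc := g2 e
        simp only [Conf5] at hc
        by_cases hli : l = i
        · subst hli
          rw [hFi]
          omega
        · by_cases hlj : l = j
          · subst hlj
            rw [hFj]
            omega
          · rw [hFl l hli hlj]; exact f2 l e he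
      · intro l
        simp [hF', hγr, f3]
      · intro e
        simp [hF', sum_sub_distrib, sum_add_distrib, f4]
    have hle := hmin F' hmem
    have hsplit : ∀ g : Fin (lam + 1) → ℤ, ∑ l, g l
        = g i + g j + ∑ l ∈ (univ.erase i).erase j, g l := by
      intro g
      rw [← add_sum_erase univ g (mem_univ i), ← add_sum_erase (univ.erase i) g (a := j)
        (by simp [hij.symm])]
      ring
    rw [hsplit, hsplit (fun l => (∑ e ∈ T, (1 - F' l e)) ^ 2)] at hle
    have hrest : ∑ l ∈ (univ.erase i).erase j, (∑ e ∈ T, (1 - F' l e)) ^ 2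
        = ∑ l ∈ (univ.erase i).erase j, (∑ e ∈ T, (1 - F l e)) ^ 2 := by
      apply sum_congr rfl
      intro l hl
      simp only [mem_erase] at hl
      rw [hFl l hl.2.1 hl.1]
    rw [hrest] at hle
    have hi' : ∑ e ∈ T, (1 - F' i e) = ∑ e ∈ T, (1 - F i e) + ∑ e ∈ T, γ e := by
      rw [← sum_add_distrib]
      apply sum_congr rfl
      intro e _
      rw [hFi]; ring
    have hj' : ∑ e ∈ T, (1 - F' j e) = ∑ e ∈ T, (1 - F j e) - ∑ e ∈ T, γ e := by
      rw [← sum_sub_distrib]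
      apply sum_congr rfl
      intro e _
      rw [hFj]; ring
    rw [hi', hj'] at hle
    generalize ∑ e ∈ T, (1 - F i e) = a at *
    generalize ∑ e ∈ T, (1 - F j e) = b at *
    generalize ∑ e ∈ T, γ e = x at *
    nlinarith
  have htot : ∑ i, ∑ e ∈ T, (1 - F i e) = T.card := by
    rw [sum_comm, sum_congr rfl (g := fun _ => (1:ℤ))]
    · simp
    · intro e he
      rw [sum_sub_distrib, f4]
      simp only [hT, mem_filter] at he
      simp [he.2.2.2.1]
  have hbound : ∀ i, ∑ e ∈ T, (1 - F i e) ≤ 2 * n := by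
    intro i
    have : ∑ j : Fin (lam + 1), (∑ e ∈ T, (1 - F i e) - n) ≤ ∑ j, ∑ e ∈ T, (1 - F j e) := by
      apply sum_le_sum
      intro j _
      have := hbal i j
      omega
    rw [htot, sum_const] at this
    simp only [card_univ, Fintype.card_fin, nsmul_eq_mul] at this
    push_cast at this
    have h7 := this.trans hTc
    have h8 : (0:ℤ) < lam + 1 := by positivity
    have := le_of_mul_le_mul_left h7 h8
    omega
  refine ⟨F, f1, f2, f3, ?_, ?_⟩
  · intro e he hNe
    by_contra hcon
    push Not at hcon
    have : ∀ i ∈ univ, F i e = 1 := by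
      intro i _
      have := f2 i e he
      have := hcon i
      omega
    have h6 := f4 e
    rw [sum_congr rfl this] at h6
    simp at h6
    have := hN e he hNe
    omega
  · intro i j
    have hcardN : ∀ i, ((T.filter (fun e => F i e = 0)).card : ℤ) ≤ 2 * n := by
      intro i
      refine le_trans ?_ (hbound i)
      rw [card_filter]
      push_cast
      apply sum_le_sum
      intro e he
      have := f2 i e (hTr e he)
      split_ifs <;> omega
    have hsub : univ.filter (fun e => F i e ≠ F j e) ⊆
        univ.filter (fun e => 0 < h e ∧ h e < (if e = r then (lam : ℤ) * (lam + 1) else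
      if N e then (lam : ℤ) else lam + 1)) ∪ (T.filter (fun e => F i e = 0) ∪
          T.filter (fun e => F j e = 0)) := by
      intro e he
      simp only [mem_filter, mem_univ, true_and] at he
      have her : e ≠ r := by
        rintro rfl
        simp [f3] at he
      have hi := f2 i e her
      have hj := f2 j e her
      have hne0 : h e ≠ 0 := by
        intro h0
        have := f4 e
        rw [h0, sum_eq_zero_iff_of_nonneg (fun l _ => (f2 l e her).1)] at this
        exact he ((this i (mem_univ _)).trans (this j (mem_univ _)).symm)
      have hne1 : h e ≠ lam + 1 := by
        intro h0
        have h9 : ∑ l, (1 - F l e) = 0 := by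
          rw [sum_sub_distrib, f4, h0]; simp
        rw [sum_eq_zero_iff_of_nonneg (fun l _ => by have := (f2 l e her).2; omega)] at h9
        have := h9 i (mem_univ _)
        have := h9 j (mem_univ _)
        omega
      have hhe := h2 e
      simp only [her, if_false] at hhe
      simp only [mem_union, mem_filter, mem_univ, true_and, her, if_false, hT, ne_eq,
        not_false_eq_true]
      by_cases hNe : N e
      · simp only [hNe, if_true, true_and] at hhe ⊢
        omega
      · simp only [hNe, if_false] at hhe ⊢
        omega
    have hA := card_le_card hsub
    have hB := card_union_le (univ.filter (fun e => 0 < h e ∧ h e < (if e = r then (lam : ℤ) * (lam + 1) else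
      if N e then (lam : ℤ) else lam + 1))) (T.filter (fun e => F i e = 0) ∪
          T.filter (fun e => F j e = 0))
    have hC := card_union_le (T.filter (fun e => F i e = 0)) (T.filter (fun e => F j e = 0))
    have := hcardN i
    have := hcardN j
    omega

theorem cut5 (src tgt : A → V) (S : Finset V) (x : A → ℤ) (hx : Circ5 src tgt x) :
    ∑ e ∈ univ.filter (fun e => src e ∈ S ∧ tgt e ∉ S), x e =
      ∑ e ∈ univ.filter (fun e => src e ∉ S ∧ tgt e ∈ S), x e := by
  have h0 : ∑ v ∈ S, ∑ e, x e * inc5 src tgt e v = 0 := sum_eq_zero fun v _ => hx v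
  rw [sum_comm] at h0
  rw [← sub_eq_zero, sum_filter, sum_filter, ← sum_sub_distrib]
  refine Eq.trans ?_ h0
  apply sum_congr rfl
  intro e _
  rw [← mul_sum]
  simp only [inc5, sum_sub_distrib, sum_ite_eq]
  by_cases h1 : src e ∈ S <;> by_cases h2 : tgt e ∈ S <;> simp [h1, h2]

theorem walk5 (src tgt : A → V) (r : A) (c h : A → ℤ) (s v : V)
    (hr : Relation.ReflTransGen (fun u v => ∃ e, e ≠ r ∧ ((src e = u ∧ tgt e = v ∧ h e < c e) ∨
      (src e = v ∧ tgt e = u ∧ 0 < h e))) s v) :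
    ∃ δ : A → ℤ, δ r = 0 ∧ (∀ e, 0 < δ e → h e < c e) ∧ (∀ e, δ e < 0 → 0 < h e) ∧
      ∀ u, ∑ e, δ e * inc5 src tgt e u = (if s = u then 1 else 0) - (if v = u then 1 else 0) := by
  induction hr with
  | refl => exact ⟨fun _ => 0, rfl, by simp, by simp, by simp⟩
  | tail _ hstep ih =>
    obtain ⟨δ, d1, d2, d3, d4⟩ := ih
    obtain ⟨e0, he0, ⟨a1, a2, a3⟩ | ⟨a1, a2, a3⟩⟩ := hstep
    · refine ⟨fun e => δ e + if e = e0 then 1 else 0, by simp [d1, he0.symm], ?_, ?_, ?_⟩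
      · intro e he
        by_cases h0 : e = e0
        · rw [h0]; exact a3
        · simp only [h0, if_false, add_zero] at he; exact d2 e he
      · intro e he
        apply d3 e
        dsimp only at he
        split_ifs at he <;> omega
      · intro u
        simp only [add_mul, sum_add_distrib, d4, ite_mul, one_mul, zero_mul, sum_ite_eq', mem_univ,
          if_true]
        simp only [inc5, a1, a2]
        ring
    · refine ⟨fun e => δ e - if e = e0 then 1 else 0, by simp [d1, he0.symm], ?_, ?_, ?_⟩
      · intro e he
        apply d2 e
        dsimp only at he
        split_ifs at he <;> omega
      · intro e he
        by_cases h0 : e = e0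
        · rw [h0]; exact a3
        · simp only [h0, if_false, sub_zero] at he; exact d3 e he
      · intro u
        simp only [sub_mul, sum_sub_distrib, d4, ite_mul, one_mul, zero_mul, sum_ite_eq', mem_univ,
          if_true]
        simp only [inc5, a1, a2]
        ring

theorem exist5 (src tgt : A → V) (r : A) (lam : ℕ) (N : A → Prop) [DecidablePred N]
    (hf : ∃ f, Circ5 src tgt f ∧ (∀ e, e ≠ r → 0 ≤ f e ∧ f e ≤ 1) ∧ f r = lam)
    (hN : ∀ e0, e0 ≠ r → N e0 →
      ∃ f, Circ5 src tgt f ∧ (∀ e, e ≠ r → 0 ≤ f e ∧ f e ≤ 1) ∧ f r = lam ∧ f e0 = 0) :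
    ∃ h, Feas5 src tgt r (fun e => if e = r then lam * (lam + 1) else
      if N e then lam else lam + 1) (lam * (lam + 1)) h := by
  classical
  set c : A → ℤ := (fun e => if e = r then lam * (lam + 1) else
      if N e then lam else lam + 1) with hc
  have hcr : c r = lam * (lam + 1) := by simp [hc]
  have hc0 : ∀ e, 0 ≤ c e := by
    intro e
    simp only [hc]
    split_ifs <;> positivity
  have hfin : {h | Circ5 src tgt h ∧ ∀ e, 0 ≤ h e ∧ h e ≤ c e}.Finite := by
    apply (Set.finite_Icc (0 : A → ℤ) c).subset
    rintro h ⟨_, h2⟩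
    exact ⟨fun e => (h2 e).1, fun e => (h2 e).2⟩
  obtain ⟨h, ⟨h1, h2⟩, hmax⟩ := Set.exists_max_image _
    (fun h : A → ℤ => h r) hfin ⟨fun _ => 0, Circ5.zero, fun e => ⟨le_rfl, hc0 e⟩⟩
  refine ⟨h, h1, h2, ?_⟩
  push_cast
  rw [← hcr]
  refine le_antisymm (h2 r).2 ?_
  by_contra hlt
  push Not at hlt
  set R : V → V → Prop := (fun u v => ∃ e, e ≠ r ∧ ((src e = u ∧ tgt e = v ∧ h e < c e) ∨
      (src e = v ∧ tgt e = u ∧ 0 < h e))) with hR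
  by_cases ht : Relation.ReflTransGen R (tgt r) (src r)
  · obtain ⟨δ, d1, d2, d3, d4⟩ := walk5 src tgt r c h _ _ ht
    obtain ⟨γ, g1, g2, g3, g4⟩ := thru5 src tgt r (fun e => δ e + if e = r then 1 else 0) (by
      intro u
      simp only [add_mul, sum_add_distrib, d4, ite_mul, one_mul, zero_mul, sum_ite_eq', mem_univ,
          if_true]
      simp only [inc5]
      ring) (by simp [d1])
    have hγr : γ r = 1 := by
      have := g2 r
      simp only [Conf5, d1, if_true] at this
      omega
    have := hmax (fun e => h e + γ e) ⟨h1.add g1, by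
      intro e
      have he := h2 e
      by_cases her : e = r
      · subst her
        dsimp only
        omega
      · have := g2 e
        simp only [Conf5, her, if_false, add_zero] at this
        have := d2 e
        have := d3 e
        dsimp only
        omega⟩
    omega
  · set S : Finset V := univ.filter (fun v => Relation.ReflTransGen R (tgt r) v) with hS
    have hsS : tgt r ∈ S := by simp [hS, Relation.ReflTransGen.refl]
    have htS : src r ∉ S := by simpa [hS] using ht
    set O := univ.filter (fun e => src e ∈ S ∧ tgt e ∉ S) with hO
    set I := univ.filter (fun e => src e ∉ S ∧ tgt e ∈ S) with hI
    have hOr : ∀ e ∈ O, e ≠ r := by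
      rintro e he rfl
      simp only [hO, mem_filter] at he
      exact htS he.2.1
    have hIr : r ∈ I := by simp only [hI, mem_filter]; exact ⟨mem_univ _, htS, hsS⟩
    have hOc : ∀ e ∈ O, h e = c e := by
      intro e he
      have her := hOr e he
      simp only [hO, hS, mem_filter, mem_univ, true_and] at he
      by_contra hne
      have := h2 e
      exact he.2 (he.1.tail ⟨e, her, Or.inl ⟨rfl, rfl, by omega⟩⟩)
    have hI0 : ∀ e ∈ I, e ≠ r → h e = 0 := by
      intro e he her
      simp only [hI, hS, mem_filter, mem_univ, true_and] at he
      by_contra hne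
      have := h2 e
      exact he.1 (he.2.tail ⟨e, her, Or.inr ⟨rfl, rfl, by omega⟩⟩)
    have hcut : ∑ e ∈ O, c e = h r := by
      rw [← sum_congr rfl hOc, hO, cut5 src tgt S h h1]
      exact sum_eq_single_of_mem r hIr hI0
    have hflow : ∀ f, Circ5 src tgt f → (∀ e, e ≠ r → 0 ≤ f e ∧ f e ≤ 1) → f r = lam →
        (lam : ℤ) ≤ ∑ e ∈ O, f e := by
      intro f f1 f2 f3
      rw [hO, cut5 src tgt S f f1, ← f3]
      apply single_le_sum (f := f) (a := r) _ hIr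
      intro e _
      by_cases her : e = r
      · rw [her, f3]; positivity
      · exact (f2 e her).1
    have hlam : (0:ℤ) ≤ lam := by positivity
    by_cases hall : ∀ e ∈ O, ¬ N e
    · obtain ⟨f, f1, f2, f3⟩ := hf
      have h5 := hflow f f1 f2 f3
      have h6 : ∑ e ∈ O, f e ≤ O.card := by
        rw [card_eq_sum_ones]
        push_cast
        exact sum_le_sum fun e he => (f2 e (hOr e he)).2
      have h7 : ∑ e ∈ O, c e = O.card * (lam + 1) := by
        rw [sum_congr rfl (g := fun _ => (lam : ℤ) + 1)]
        · simp
        · intro e he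
          simp [hc, hOr e he, hall e he]
      nlinarith
    · push Not at hall
      obtain ⟨e0, he0, hNe0⟩ := hall
      obtain ⟨f, f1, f2, f3, f4⟩ := hN e0 (hOr e0 he0) hNe0
      have h5 := hflow f f1 f2 f3
      have h6 : ∑ e ∈ O, f e + 1 ≤ O.card := by
        have h8 : ∑ e ∈ O, f e < ∑ e ∈ O, (1:ℤ) :=
          sum_lt_sum (fun e he => (f2 e (hOr e he)).2) ⟨e0, he0, by rw [f4]; norm_num⟩
        simp at h8
        omega
      have h7 : O.card * (lam : ℤ) ≤ ∑ e ∈ O, c e := by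
        rw [← nsmul_eq_mul, ← sum_const]
        apply sum_le_sum
        intro e he
        simp only [hc, hOr e he, if_false]
        split_ifs <;> omega
      nlinarith

end FlowTools

section Convert
variable {V E : Type} [Fintype V] [DecidableEq V] [Fintype E] [DecidableEq E]

theorem dv5 (G : Digraph' V E) (s t : V) (x : Option E → ℤ) (v : V) :
    ∑ e, x e * inc5 (fun o => Option.elim o t G.src) (fun o => Option.elim o s G.tgt) e v =
      x none * ((if t = v then 1 else 0) - (if s = v then 1 else 0)) +
      (∑ e ∈ univ.filter (fun e => G.src e = v), x (some e) -
        ∑ e ∈ univ.filter (fun e => G.tgt e = v), x (some e)) := by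
  rw [Fintype.sum_option]
  change x none * ((if t = v then 1 else 0) - (if s = v then 1 else 0)) +
    ∑ e : E, x (some e) * ((if G.src e = v then 1 else 0) - (if G.tgt e = v then 1 else 0)) = _
  congr 1
  rw [sum_filter, sum_filter, ← sum_sub_distrib]
  apply sum_congr rfl
  intro e _
  simp only [mul_sub, mul_ite, mul_one, mul_zero]

theorem toCirc5 (G : Digraph' V E) (s t : V) (hst : s ≠ t) (f : E → ℕ) (hf : G.IsFlow s t f) :
    Circ5 (fun o => Option.elim o t G.src) (fun o => Option.elim o s G.tgt)
      (fun o => Option.elim o (G.flowValue s f) (fun e => (f e : ℤ))) := by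
  have hne : ∀ v, v ≠ t → ∑ e, (fun o => Option.elim o (G.flowValue s f) (fun e => (f e : ℤ))) e *
      inc5 (fun o => Option.elim o t G.src) (fun o => Option.elim o s G.tgt) e v = 0 := by
    intro v hv
    rw [dv5]
    by_cases hs : v = s
    · subst hs
      simp [hst.symm, Digraph'.flowValue]
    · have h1 := hf.2 v hs hv
      have h2 : (∑ e ∈ univ.filter (fun e => G.tgt e = v), (f e : ℤ)) =
        ∑ e ∈ univ.filter (fun e => G.src e = v), (f e : ℤ) := by exact_mod_cast h1
      simp [Ne.symm hs, Ne.symm hv, h2]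
  intro v
  by_cases hv : v = t
  · subst hv
    rw [← sum_eq_single_of_mem (s := univ) (f := fun u => ∑ e, (fun o => Option.elim o
      (G.flowValue s f) (fun e => (f e : ℤ))) e *
      inc5 (fun o => Option.elim o v G.src) (fun o => Option.elim o s G.tgt) e u) v (mem_univ _)
      (fun u _ hu => hne u hu)]
    rw [sum_comm]
    apply sum_eq_zero
    intro e _
    rw [← mul_sum]
    simp [inc5]
  · exact hne v hv

theorem ofCirc5 (G : Digraph' V E) (s t : V) (hst : s ≠ t) (x : Option E → ℤ)
    (hx : Circ5 (fun o => Option.elim o t G.src) (fun o => Option.elim o s G.tgt) x)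
    (hb : ∀ e, 0 ≤ x (some e) ∧ x (some e) ≤ 1) :
    G.IsFlow s t (fun e => (x (some e)).toNat) ∧
      G.flowValue s (fun e => (x (some e)).toNat) = x none := by
  have hcast : ∀ e, ((x (some e)).toNat : ℤ) = x (some e) := fun e => Int.toNat_of_nonneg (hb e).1
  refine ⟨⟨fun e => ?_, ?_⟩, ?_⟩
  · have := hb e
    dsimp only
    omega
  · intro v hs ht
    have := hx v
    rw [dv5] at this
    simp only [Ne.symm hs, Ne.symm ht, if_false, sub_self, mul_zero, zero_add] at this
    zify
    simp only [hcast]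
    linarith
  · have := hx s
    rw [dv5] at this
    simp only [hst.symm, if_false, if_true] at this
    simp only [Digraph'.flowValue, hcast]
    linarith

end Convert

/-- If `λ` is the value of a maximum `(s,t)`-flow of `G` and `n = |V|`,
then there exists a family `B` of `2λ+1` `(s,t)`-flows of `G` such that (1) for every
edge `e`, `B` contains a flow `f` with `f e = 0` whose value equals the maximum
`(s,t)`-flow value of `G − e`, and (2) any two flows of `B` disagree on at most `6n`
edges. -/
theorem stmt2 {V E : Type} [Fintype V] [DecidableEq V] [Fintype E] [DecidableEq E]
    (G : Digraph' V E) (s t : V) (hst : s ≠ t) (lam : ℕ)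
    (hmax : G.IsMaxFlowValue s t ∅ lam) :
    ∃ B : Fin (2 * lam + 1) → E → ℕ,
      (∀ i, G.IsFlow s t (B i)) ∧
      (∀ e : E, ∃ i, B i e = 0 ∧
        G.IsMaxFlowValue s t {e} (G.flowValue s (B i))) ∧
      (∀ i j, (univ.filter (fun e => B i e ≠ B j e)).card ≤ 6 * Fintype.card V) := by
  classical
  set src : Option E → V := (fun o => Option.elim o t G.src) with hsrc
  set tgt : Option E → V := (fun o => Option.elim o s G.tgt) with htgt
  obtain ⟨⟨f0, hf0, -, hv0⟩, hmx⟩ := hmax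
  have hmx' : ∀ f, G.IsFlow s t f → G.flowValue s f ≤ lam := fun f hf => hmx f hf (by simp)
  set N : Option E → Prop := fun o => ∃ e, o = some e ∧
    ∃ f, G.IsFlow s t f ∧ G.flowValue s f = lam ∧ f e = 0 with hN
  have hbd : ∀ f, G.IsFlow s t f → ∀ o : Option E, o ≠ none →
      0 ≤ Option.elim o (G.flowValue s f) (fun e => (f e : ℤ)) ∧
      Option.elim o (G.flowValue s f) (fun e => (f e : ℤ)) ≤ 1 := by
    intro f hf o ho
    cases o with
    | none => exact absurd rfl ho
    | some e =>
      have := hf.1 e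
      simp only [Option.elim_some]
      omega
  have hex := exist5 src tgt none lam N
    ⟨_, toCirc5 G s t hst f0 hf0, hbd f0 hf0, by simpa using hv0⟩ (by
      rintro e0 _ ⟨e, rfl, f, hf, hv, hfe⟩
      exact ⟨_, toCirc5 G s t hst f hf, hbd f hf, by simpa using hv, by simp [hfe]⟩)
  obtain ⟨F, F1, F2, F3, F4, F5⟩ := core5 src tgt none lam N hex
  obtain ⟨P, P1, P2, P3, P4, P5⟩ := paths5 src tgt none lam (F 0) (F1 0) (by
    intro e
    by_cases he : e = none
    · subst he; rw [F3]; positivity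
    · exact (F2 0 e he).1) (F3 0)
  have hPF : ∀ k e, P k e ≤ F 0 e := fun k e =>
    (single_le_sum (f := fun i => P i e) (fun i _ => (P2 i e).1) (mem_univ k)).trans (P5 e)
  -- the family as circulations
  set X : Fin (lam + 1) ⊕ Fin lam → Option E → ℤ :=
    Sum.elim F (fun k e => F 0 e - P k e) with hX
  have X1 : ∀ i, Circ5 src tgt (X i) := by
    rintro (i | k)
    · exact F1 i
    · exact (F1 0).sub (P1 k)
  have X2 : ∀ i e, 0 ≤ X i (some e) ∧ X i (some e) ≤ 1 := by
    rintro (i | k) e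
    · exact F2 i _ (by simp)
    · have := F2 0 (some e) (by simp)
      have := hPF k (some e)
      have := P2 k (some e)
      simp only [hX, Sum.elim_inr]
      omega
  have XP : ∀ i k, (univ.filter (fun e => X (Sum.inl i) e ≠ X (Sum.inr k) e)).card
      ≤ 6 * Fintype.card V := by
    intro i k
    have hsub : univ.filter (fun e => X (Sum.inl i) e ≠ X (Sum.inr k) e) ⊆
        univ.filter (fun e => F i e ≠ F 0 e) ∪ univ.filter (fun e => P k e ≠ 0) := by
      intro e he
      simp only [hX, mem_filter, mem_univ, true_and, Sum.elim_inl, Sum.elim_inr, mem_union] at he ⊢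
      omega
    have := (card_le_card hsub).trans (card_union_le _ _)
    have := F5 i 0
    have := P4 k
    omega
  have X3 : ∀ i j, (univ.filter (fun e => X i e ≠ X j e)).card ≤ 6 * Fintype.card V := by
    rintro (i | k) (j | l)
    · have := F5 i j
      simp only [hX, Sum.elim_inl]
      omega
    · exact XP i l
    · have := XP j k
      simp only [ne_comm] at this ⊢
      exact this
    · have hsub : univ.filter (fun e => X (Sum.inr k) e ≠ X (Sum.inr l) e) ⊆
          univ.filter (fun e => P k e ≠ 0) ∪ univ.filter (fun e => P l e ≠ 0) := by
        intro e he
        simp only [hX, mem_filter, mem_univ, true_and, Sum.elim_inr, mem_union] at he ⊢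
        omega
      have := (card_le_card hsub).trans (card_union_le _ _)
      have := P4 k
      have := P4 l
      omega
  have X4 : ∀ e, ∃ i, X i (some e) = 0 ∧ G.IsMaxFlowValue s t {e} (X i none) := by
    intro e
    by_cases hNe : N (some e)
    · obtain ⟨i, hi⟩ := F4 (some e) (by simp) hNe
      refine ⟨Sum.inl i, hi, ?_, ?_⟩
      · obtain ⟨e', he', f, hf, hv, hfe⟩ := hNe
        obtain rfl := Option.some.inj he'
        exact ⟨f, hf, by simpa using hfe, by simp [hX, F3, hv]⟩
      · intro f hf _
        simpa [hX, F3] using hmx' f hf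
    · have hk : ∃ k, P k (some e) ≠ 0 := by
        by_contra hcon
        push Not at hcon
        apply hNe
        obtain ⟨a1, a2⟩ := ofCirc5 G s t hst (fun o => ∑ k, P k o) (Circ5.sum _ fun i _ => P1 i)
          (fun e' => ⟨sum_nonneg fun i _ => (P2 i _).1, (P5 _).trans (F2 0 (some e') (by simp)).2⟩)
        exact ⟨e, rfl, _, a1, by rw [a2]; simp [P3], by simp [hcon]⟩
      obtain ⟨k, hk⟩ := hk
      have h0 : X (Sum.inr k) (some e) = 0 := by
        have := F2 0 (some e) (by simp)
        have := hPF k (some e)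
        have := P2 k (some e)
        simp only [hX, Sum.elim_inr]
        omega
      refine ⟨Sum.inr k, h0, ?_, ?_⟩
      · obtain ⟨a1, a2⟩ := ofCirc5 G s t hst _ (X1 (Sum.inr k)) (X2 (Sum.inr k))
        exact ⟨_, a1, by simp [h0], a2⟩
      · intro f hf hfe
        have h1 := hmx' f hf
        have h2 : G.flowValue s f ≠ lam := fun h => hNe ⟨e, rfl, f, hf, h, hfe e (by simp)⟩
        simp only [hX, Sum.elim_inr, F3, P3]
        omega
  have eqv : Fin (2 * lam + 1) ≃ Fin (lam + 1) ⊕ Fin lam :=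
    (finCongr (by omega)).trans finSumFinEquiv.symm
  refine ⟨fun i e => (X (eqv i) (some e)).toNat, ?_, ?_, ?_⟩
  · intro i
    exact (ofCirc5 G s t hst _ (X1 _) (X2 _)).1
  · intro e
    obtain ⟨i, hi, hm⟩ := X4 e
    refine ⟨eqv.symm i, by simp [hi], ?_⟩
    have := (ofCirc5 G s t hst _ (X1 i) (X2 i)).2
    simp only [Equiv.apply_symm_apply]
    rw [this]
    exact hm
  · intro i j
    refine le_trans ?_ (X3 (eqv i) (eqv j))
    rw [← card_map Function.Embedding.some]
    apply card_le_card
    intro o ho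
    simp only [mem_map, mem_filter, mem_univ, true_and] at ho ⊢
    obtain ⟨e, he, rfl⟩ := ho
    intro h
    apply he
    simp only [Function.Embedding.some_apply] at h
    rw [h]
end

section
/- Assume every vertex of G lies on some directed path from s to t. Let E' be a set of k edges of G. Then the maximum (s,t)-flow value of G − E' equals λ − k if and only if every edge of E' is critical and E', regarded as a set of edges of the strip graph D_λ, is an antichain. -/
open Finset

namespace Digraph'

variable {V E : Type} [Fintype V] [DecidableEq V] [Fintype E] [DecidableEq E]

/-- An `(s,t)`-min-cut partition: `(A, Aᶜ)` with `s ∈ A`, `t ∉ A`, and exactly `λ`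
edges of `G` directed from `A` to `Aᶜ`. -/
def IsMinCutPartition (G : Digraph' V E) (s t : V) (lam : ℕ) (A : Finset V) : Prop :=
  s ∈ A ∧ t ∉ A ∧ (univ.filter (fun e => G.src e ∈ A ∧ G.tgt e ∉ A)).card = lam

/-- Two vertices are equivalent if every `(s,t)`-min-cut partition has them on the
same side. -/
def VEquiv (G : Digraph' V E) (s t : V) (lam : ℕ) (x y : V) : Prop :=
  ∀ A : Finset V, G.IsMinCutPartition s t lam A → (x ∈ A ↔ y ∈ A)

/-- An inter-cluster edge: its endpoints are separated by some min-cut partition. -/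
def InterCluster (G : Digraph' V E) (s t : V) (lam : ℕ) (e : E) : Prop :=
  ¬ G.VEquiv s t lam (G.src e) (G.tgt e)

/-- `u` and `v` are the tail and head of edge `e` in the strip graph `D_λ`:
critical edges keep their orientation, non-critical edges are reversed. -/
def DEnds (G : Digraph' V E) (s t : V) (e : E) (u v : V) : Prop :=
  (G.Critical s t e ∧ u = G.src e ∧ v = G.tgt e) ∨
    (¬ G.Critical s t e ∧ u = G.tgt e ∧ v = G.src e)

/-- One step in the strip graph `D_λ` (on representatives): either stay within an
equivalence class, or traverse an inter-cluster edge in its `D_λ`-orientation. -/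
def DStep (G : Digraph' V E) (s t : V) (lam : ℕ) (u v : V) : Prop :=
  G.VEquiv s t lam u v ∨
    ∃ e : E, G.InterCluster s t lam e ∧ G.DEnds s t e u v

/-- Reachability in the strip graph `D_λ` (between classes, via representatives). -/
def DReach (G : Digraph' V E) (s t : V) (lam : ℕ) : V → V → Prop :=
  Relation.ReflTransGen (G.DStep s t lam)

/-- The partial order on edges of `D_λ`: `e ≤ e'` iff `e = e'` or some directed
path of `D_λ` from the class of `s` to the class of `t` traverses `e` before `e'`. -/
def EdgeLE (G : Digraph' V E) (s t : V) (lam : ℕ) (e e' : E) : Prop :=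
  e = e' ∨ ∃ u v u' v' : V, G.DEnds s t e u v ∧ G.DEnds s t e' u' v' ∧
    G.DReach s t lam s u ∧ G.DReach s t lam v u' ∧ G.DReach s t lam v' t

/-- A set of edges of `G`, regarded as edges of `D_λ`, is an antichain if its
elements are pairwise incomparable under `EdgeLE`. -/
def EdgeAntichain (G : Digraph' V E) (s t : V) (lam : ℕ) (C : Finset E) : Prop :=
  ∀ e ∈ C, ∀ e' ∈ C, G.EdgeLE s t lam e e' → e = e'

end Digraph'

namespace Digraph'

section aux
set_option linter.unusedSectionVars false
variable {V E : Type} [Fintype V] [DecidableEq V] [Fintype E] [DecidableEq E]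

/-- Edges leaving `A`. -/
def dl (G : Digraph' V E) (A : Finset V) : Finset E :=
  univ.filter (fun e => G.src e ∈ A ∧ G.tgt e ∉ A)

/-- signed incidence of an edge with a vertex set -/
def inc (G : Digraph' V E) (A : Finset V) (e : E) : ℤ :=
  (if G.src e ∈ A then 1 else 0) - (if G.tgt e ∈ A then 1 else 0)

/-- excess -/
def exc (G : Digraph' V E) (f : E → ℕ) (x : V) : ℤ :=
  ∑ e, (f e : ℤ) * G.inc {x} e

lemma exc_eq_sub (G : Digraph' V E) (f : E → ℕ) (x : V) :
    G.exc f x = (∑ e ∈ univ.filter (fun e => G.src e = x), (f e : ℤ)) -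
      ∑ e ∈ univ.filter (fun e => G.tgt e = x), (f e : ℤ) := by
  unfold exc inc
  rw [Finset.sum_filter, Finset.sum_filter, ← Finset.sum_sub_distrib]
  refine Finset.sum_congr rfl fun e _ => ?_
  simp only [Finset.mem_singleton]
  split_ifs <;> simp

lemma inc_sum (G : Digraph' V E) (A : Finset V) (e : E) :
    ∑ x ∈ A, G.inc {x} e = G.inc A e := by
  unfold inc
  rw [Finset.sum_sub_distrib]
  simp

lemma sum_exc (G : Digraph' V E) (f : E → ℕ) (A : Finset V) :
    ∑ x ∈ A, G.exc f x = ∑ e, (f e : ℤ) * G.inc A e := by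
  unfold exc
  rw [Finset.sum_comm]
  refine Finset.sum_congr rfl fun e _ => ?_
  rw [← Finset.mul_sum, inc_sum]

lemma exc_zero_of_conserves {G : Digraph' V E} {s t : V} {f : E → ℕ}
    (h : G.Conserves s t f) (x : V) (hs : x ≠ s) (ht : x ≠ t) : G.exc f x = 0 := by
  rw [exc_eq_sub, sub_eq_zero]
  exact_mod_cast (h x hs ht).symm

lemma exc_t {G : Digraph' V E} {s t : V} {f : E → ℕ} (hst : s ≠ t)
    (h : G.Conserves s t f) : G.exc f t = - G.exc f s := by
  have h1 := G.sum_exc f univ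
  have h2 : ∑ e, (f e : ℤ) * G.inc univ e = 0 := by simp [inc]
  have h3 : ∑ x, G.exc f x = ∑ x ∈ {s, t}, G.exc f x := by
    symm
    apply Finset.sum_subset (Finset.subset_univ _)
    intro x _ hx
    simp only [Finset.mem_insert, Finset.mem_singleton, not_or] at hx
    exact exc_zero_of_conserves h x hx.1 hx.2
  rw [Finset.sum_pair hst] at h3
  linarith

lemma flow_cut {G : Digraph' V E} {s t : V} {f : E → ℕ} (hst : s ≠ t)
    (h : G.Conserves s t f) (A : Finset V) :
    ∑ e, (f e : ℤ) * G.inc A e =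
      G.flowValue s f * ((if s ∈ A then 1 else 0) - (if t ∈ A then 1 else 0)) := by
  rw [← sum_exc]
  have hv : G.flowValue s f = G.exc f s := by rw [exc_eq_sub]; rfl
  rw [hv]
  have key : ∀ x, G.exc f x =
      (if x = s then G.exc f s else 0) - (if x = t then G.exc f s else 0) := by
    intro x
    by_cases h1 : x = s
    · subst h1; simp [hst]
    · by_cases h2 : x = t
      · subst h2; simp [h1, exc_t hst h]
      · simp [h1, h2, exc_zero_of_conserves h x h1 h2]
  rw [Finset.sum_congr rfl (fun x _ => key x), Finset.sum_sub_distrib]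
  simp only [Finset.sum_ite_eq']
  split_ifs <;> simp

/-- A reachable vertex is joined by an edge set of the right divergence. -/
lemma path_set (G : Digraph' V E) (v : V) : ∀ (n : ℕ) (F : Finset E) (u : V),
    (Fᶜ).card ≤ n → G.ReachAvoid F u v →
    ∃ P : Finset E, Disjoint P F ∧ ∀ x, ∑ e ∈ P, G.inc {x} e =
      (if u = x then 1 else 0) - (if v = x then 1 else 0) := by
  intro n
  induction n with
  | zero =>
    intro F u hn hr
    have : u = v := by
      rcases Relation.ReflTransGen.cases_head hr with h | ⟨w, ⟨e, he, _⟩, _⟩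
      · exact h
      · exfalso
        have : (Fᶜ).card ≠ 0 := Finset.card_ne_zero_of_mem (Finset.mem_compl.2 he)
        omega
    subst this
    exact ⟨∅, by simp, by simp⟩
  | succ n ih =>
    intro F u hn hr
    by_cases huv : u = v
    · subst huv
      exact ⟨∅, by simp, by simp⟩
    set S : Finset E := F ∪ univ.filter (fun e => G.src e = u) with hS
    have key : ∀ x, G.ReachAvoid F x v → G.ReachAvoid S x v ∨
        ∃ e, e ∉ F ∧ G.src e = u ∧ G.ReachAvoid S (G.tgt e) v := by
      intro x hx
      induction hx using Relation.ReflTransGen.head_induction_on with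
      | refl => exact Or.inl Relation.ReflTransGen.refl
      | head h1 h2 ih2 =>
        obtain ⟨e, he, h3, h4⟩ := h1
        rcases ih2 with h5 | h5
        · by_cases hxu : G.src e = u
          · right
            exact ⟨e, he, hxu, by rw [h4]; exact h5⟩
          · left
            refine Relation.ReflTransGen.head ⟨e, ?_, h3, h4⟩ h5
            simp [hS, he, hxu]
        · exact Or.inr h5
    have hu : ∃ e, e ∉ F ∧ G.src e = u ∧ G.ReachAvoid S (G.tgt e) v := by
      rcases key u hr with h | h
      · rcases Relation.ReflTransGen.cases_head h with h | ⟨w, ⟨e, he, h2, _⟩, _⟩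
        · exact absurd h huv
        · exact absurd h2 (by simp [hS] at he; exact he.2)
      · exact h
    obtain ⟨e, heF, heu, hre⟩ := hu
    have heS : e ∈ S := by simp [hS, heu]
    have hcard : (Sᶜ).card ≤ n := by
      have : Sᶜ ⊂ Fᶜ := by
        rw [Finset.ssubset_iff_of_subset]
        · exact ⟨e, by simpa using heF, by simpa using heS⟩
        · intro y hy
          simp only [hS, Finset.mem_compl, Finset.mem_union, not_or] at hy ⊢
          exact hy.1
      have := Finset.card_lt_card this
      omega
    obtain ⟨P, hP, hd⟩ := ih S (G.tgt e) hcard hre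
    have heP : e ∉ P := fun h => Finset.disjoint_left.1 hP h heS
    refine ⟨insert e P, ?_, ?_⟩
    · rw [Finset.disjoint_insert_left]
      exact ⟨heF, hP.mono_right Finset.subset_union_left⟩
    · intro x
      rw [Finset.sum_insert heP, hd x]
      simp only [inc, Finset.mem_singleton, heu]
      ring

lemma mfmc {G : Digraph' V E} {s t : V} (hst : s ≠ t) {F : Finset E} {m : ℤ}
    (h : G.IsMaxFlowValue s t F m) :
    ∃ A : Finset V, s ∈ A ∧ t ∉ A ∧ ((G.dl A \ F).card : ℤ) = m := by
  classical
  obtain ⟨⟨f, ⟨hf1, hfc⟩, hfF, hfm⟩, hub⟩ := h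
  have hnt : ¬ (G.residual f).ReachAvoid F s t := by
    intro hr
    obtain ⟨P, hP, hd⟩ := (G.residual f).path_set t _ F s le_rfl hr
    set f' : E → ℕ := fun e => if e ∈ P then 1 - f e else f e with hf'
    have hexc : ∀ x, G.exc f' x =
        G.exc f x + ((if s = x then 1 else 0) - (if t = x then 1 else 0)) := by
      intro x
      rw [← hd x]
      unfold exc
      rw [← Finset.sum_filter_add_sum_filter_not univ (fun e => e ∈ P),
        ← Finset.sum_filter_add_sum_filter_not univ (fun e => e ∈ P) (fun e => (f e : ℤ) * _)]
      have h1 : univ.filter (fun e => e ∈ P) = P := by ext; simp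
      rw [h1, add_right_comm, ← Finset.sum_add_distrib]
      congr 1
      · refine Finset.sum_congr rfl fun e he => ?_
        have := hf1 e
        simp only [hf', he, if_true, inc, residual]
        rcases (by omega : f e = 0 ∨ f e = 1) with h0 | h0 <;> simp [h0]
      · refine Finset.sum_congr rfl fun e he => ?_
        have he' : e ∉ P := by simpa using he
        simp [hf', he']
    have hcons : G.Conserves s t f' := by
      intro x hs ht
      have h1 := hexc x
      rw [exc_zero_of_conserves hfc x hs ht, exc_eq_sub] at h1
      simp only [hs.symm, ht.symm, if_false] at h1
      have h2 := sub_eq_zero.1 (h1.trans (by norm_num))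
      exact_mod_cast h2.symm
    have hfl : G.IsFlow s t f' := by
      refine ⟨fun e => ?_, hcons⟩
      have := hf1 e
      simp only [hf']
      split_ifs <;> omega
    have h3 := hub f' hfl (by
      intro e he
      have : e ∉ P := fun h => Finset.disjoint_left.1 hP h he
      simp [hf', this, hfF e he])
    have h4 : G.flowValue s f' = G.flowValue s f + 1 := by
      have h5 := hexc s
      rw [exc_eq_sub, exc_eq_sub] at h5
      simp only [if_true, hst.symm, if_false, sub_zero] at h5
      exact h5
    omega
  set A : Finset V := univ.filter (fun v => (G.residual f).ReachAvoid F s v) with hA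
  have hsA : s ∈ A := by simp [hA]; exact Relation.ReflTransGen.refl
  have htA : t ∉ A := by simpa [hA] using hnt
  refine ⟨A, hsA, htA, ?_⟩
  have hc := flow_cut hst hfc A
  rw [hfm] at hc
  simp only [hsA, htA, if_true, if_false, sub_zero, mul_one] at hc
  have hcard : ((G.dl A \ F).card : ℤ) = ∑ e, if e ∈ G.dl A \ F then (1 : ℤ) else 0 := by
    rw [Finset.sum_ite_mem, Finset.univ_inter]; simp
  rw [← hc, hcard]
  refine Finset.sum_congr rfl fun e _ => ?_
  by_cases heF : e ∈ F
  · simp [heF, hfF e heF]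
  have hstep : (G.residual f).src e ∈ A → (G.residual f).tgt e ∈ A := by
    simp only [hA, Finset.mem_filter, Finset.mem_univ, true_and]
    intro h
    exact Relation.ReflTransGen.tail h ⟨e, heF, rfl, rfl⟩
  have := hf1 e
  rcases (by omega : f e = 0 ∨ f e = 1) with h0 | h0
  · simp only [residual, h0] at hstep
    simp only [dl, Finset.mem_sdiff, Finset.mem_filter, Finset.mem_univ, true_and, heF, h0]
    simp at hstep ⊢
    exact hstep
  · simp only [residual, h0, if_true] at hstep
    simp only [dl, Finset.mem_sdiff, Finset.mem_filter, Finset.mem_univ, true_and, heF, h0, inc]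
    by_cases h1 : G.src e ∈ A <;> by_cases h2 : G.tgt e ∈ A <;> simp_all

lemma sum_dl (G : Digraph' V E) (A : Finset V) :
    ((G.dl A).card : ℤ) = ∑ e, if e ∈ G.dl A then (1 : ℤ) else 0 := by
  simp

/-- weak duality, avoiding `F` -/
lemma weak {G : Digraph' V E} {s t : V} (hst : s ≠ t) {F : Finset E} {f : E → ℕ}
    (hf : G.IsFlow s t f) (hF : ∀ e ∈ F, f e = 0) {A : Finset V} (hs : s ∈ A) (ht : t ∉ A) :
    G.flowValue s f ≤ (G.dl A \ F).card := by
  have hc := flow_cut hst hf.2 A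
  simp only [hs, ht, if_true, if_false, sub_zero, mul_one] at hc
  have hcard : ((G.dl A \ F).card : ℤ) = ∑ e, if e ∈ G.dl A \ F then (1 : ℤ) else 0 := by
    rw [Finset.sum_ite_mem, Finset.univ_inter]; simp
  rw [← hc, hcard]
  refine Finset.sum_le_sum fun e _ => ?_
  by_cases heF : e ∈ F
  · simp [heF, hF e heF]
  have := hf.1 e
  rcases (by omega : f e = 0 ∨ f e = 1) with h0 | h0
  · simp only [h0]; split_ifs <;> simp
  · simp only [dl, Finset.mem_sdiff, Finset.mem_filter, Finset.mem_univ, true_and, heF, h0, inc]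
    by_cases h1 : G.src e ∈ A <;> by_cases h2 : G.tgt e ∈ A <;> simp_all

lemma dl_isCut {G : Digraph' V E} {s t : V} {A : Finset V} (hs : s ∈ A) (ht : t ∉ A) :
    G.IsCut s t (G.dl A) := by
  intro h
  apply ht
  clear ht
  induction h with
  | refl => exact hs
  | tail _ h2 ih =>
    obtain ⟨e, he, h3, h4⟩ := h2
    by_contra h5
    exact he (by simp only [dl, Finset.mem_filter, Finset.mem_univ, true_and, h3, h4]; exact ⟨ih, h5⟩)

lemma cut_dl {G : Digraph' V E} {s t : V} {C : Finset E} (h : G.IsCut s t C) :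
    ∃ A : Finset V, s ∈ A ∧ t ∉ A ∧ G.dl A ⊆ C := by
  classical
  refine ⟨univ.filter (fun v => G.ReachAvoid C s v), ?_, ?_, ?_⟩
  · simp only [Finset.mem_filter, Finset.mem_univ, true_and]; exact Relation.ReflTransGen.refl
  · simpa [IsCut] using h
  · intro e he
    simp only [dl, Finset.mem_filter, Finset.mem_univ, true_and] at he
    by_contra hC
    exact he.2 (Relation.ReflTransGen.tail he.1 ⟨e, hC, rfl, rfl⟩)

section main
variable {G : Digraph' V E} {s t : V} {lam : ℕ}

lemma lam_le (hst : s ≠ t) (hmax : G.IsMaxFlowValue s t ∅ lam) {A : Finset V}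
    (hs : s ∈ A) (ht : t ∉ A) : lam ≤ (G.dl A).card := by
  obtain ⟨⟨f, hf, h0, hv⟩, _⟩ := hmax
  have := weak hst hf h0 hs ht
  rw [hv] at this
  simpa using this

lemma minCut_of_part (hst : s ≠ t) (hmax : G.IsMaxFlowValue s t ∅ lam) {A : Finset V}
    (hA : G.IsMinCutPartition s t lam A) : G.IsMinCut s t (G.dl A) := by
  refine ⟨dl_isCut hA.1 hA.2.1, fun C hC => ?_⟩
  obtain ⟨B, h1, h2, h3⟩ := cut_dl hC
  have h4 := lam_le hst hmax h1 h2
  have h5 := Finset.card_le_card h3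
  have h6 : (G.dl A).card = lam := hA.2.2
  omega

lemma part_of_critical (hst : s ≠ t) (hmax : G.IsMaxFlowValue s t ∅ lam) {e : E}
    (he : G.Critical s t e) : ∃ A, G.IsMinCutPartition s t lam A ∧ e ∈ G.dl A := by
  obtain ⟨C, hC, heC⟩ := he
  obtain ⟨B, h1, h2, h3⟩ := mfmc hst hmax
  have h4 := hC.2 _ (dl_isCut h1 h2)
  obtain ⟨A, h5, h6, h7⟩ := cut_dl hC.1
  have h8 := lam_le hst hmax h5 h6
  have h9 := Finset.card_le_card h7
  simp only [Finset.sdiff_empty, Nat.cast_inj] at h3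
  have h10 : G.dl A = C := Finset.eq_of_subset_of_card_le h7 (by omega)
  refine ⟨A, ⟨h5, h6, ?_⟩, h10 ▸ heC⟩
  change (G.dl A).card = lam
  omega

lemma part_flow (hst : s ≠ t) {f : E → ℕ} (hf : G.IsFlow s t f) (hv : G.flowValue s f = lam)
    {A : Finset V} (hA : G.IsMinCutPartition s t lam A) (e : E) :
    (f e : ℤ) * G.inc A e = if e ∈ G.dl A then 1 else 0 := by
  have hc := flow_cut hst hf.2 A
  simp only [hA.1, hA.2.1, if_true, if_false, sub_zero, mul_one, hv] at hc
  have hd : ((G.dl A).card : ℤ) = lam := by exact_mod_cast hA.2.2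
  rw [sum_dl, ← hc] at hd
  refine (Finset.sum_eq_sum_iff_of_le (fun e _ => ?_)).1 hd.symm e (Finset.mem_univ e)
  have := hf.1 e
  rcases (by omega : f e = 0 ∨ f e = 1) with h0 | h0
  · simp only [h0]; split_ifs <;> simp
  · simp only [dl, Finset.mem_filter, Finset.mem_univ, true_and, h0, inc]
    by_cases h1 : G.src e ∈ A <;> by_cases h2 : G.tgt e ∈ A <;> simp_all

lemma critical_flow (hst : s ≠ t) (hmax : G.IsMaxFlowValue s t ∅ lam)
    {f : E → ℕ} (hf : G.IsFlow s t f) (hv : G.flowValue s f = lam) {e : E}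
    (he : G.Critical s t e) : f e = 1 := by
  obtain ⟨A, hA, h⟩ := part_of_critical hst hmax he
  have h1 := part_flow hst hf hv hA e
  rw [if_pos h] at h1
  have := hf.1 e
  rcases (by omega : f e = 0 ∨ f e = 1) with h0 | h0
  · simp [h0] at h1
  · exact h0

lemma back_flow (hst : s ≠ t)
    {f : E → ℕ} (hf : G.IsFlow s t f) (hv : G.flowValue s f = lam) {A : Finset V}
    (hA : G.IsMinCutPartition s t lam A) {e : E}
    (h1 : G.src e ∉ A) (h2 : G.tgt e ∈ A) : f e = 0 := by
  have h := part_flow hst hf hv hA e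
  simpa [inc, dl, h1, h2] using h

lemma part_step (hst : s ≠ t) (hmax : G.IsMaxFlowValue s t ∅ lam) {A : Finset V}
    (hA : G.IsMinCutPartition s t lam A) {u v : V} (h : G.DStep s t lam u v) (hv : v ∈ A) :
    u ∈ A := by
  rcases h with h | ⟨e, _, ⟨hc, rfl, rfl⟩ | ⟨hc, rfl, rfl⟩⟩
  · exact (h A hA).2 hv
  · by_contra hu
    obtain ⟨f, hf, _, hfv⟩ := hmax.1
    have h1 := critical_flow hst hmax hf hfv hc
    have h2 := back_flow hst hf hfv hA hu hv
    omega
  · by_contra hu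
    exact hc ⟨G.dl A, minCut_of_part hst hmax hA, by simp [dl, hu, hv]⟩

lemma part_reach (hst : s ≠ t) (hmax : G.IsMaxFlowValue s t ∅ lam) {A : Finset V}
    (hA : G.IsMinCutPartition s t lam A) {u v : V} (h : G.DReach s t lam u v) (hv : v ∈ A) :
    u ∈ A := by
  induction h using Relation.ReflTransGen.head_induction_on with
  | refl => exact hv
  | head h1 _ ih => exact part_step hst hmax hA h1 ih

lemma closed_val (hst : s ≠ t) (hmax : G.IsMaxFlowValue s t ∅ lam) {R : Finset V}
    (hR : ∀ u v, G.DStep s t lam u v → u ∈ R → v ∈ R) :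
    (lam : ℤ) * ((if s ∈ R then 1 else 0) - (if t ∈ R then 1 else 0)) = - ((G.dl Rᶜ).card : ℤ) := by
  obtain ⟨f, hf, _, hfv⟩ := hmax.1
  rw [← hfv, ← flow_cut hst hf.2 R, sum_dl, ← Finset.sum_neg_distrib]
  refine Finset.sum_congr rfl fun e _ => ?_
  by_cases h1 : G.src e ∈ R <;> by_cases h2 : G.tgt e ∈ R
  · simp [inc, dl, h1, h2]
  · have hic : G.InterCluster s t lam e := fun h => h2 (hR _ _ (Or.inl h) h1)
    have hnc : ¬ G.Critical s t e := fun h =>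
      h2 (hR _ _ (Or.inr ⟨e, hic, Or.inl ⟨h, rfl, rfl⟩⟩) h1)
    have hz : f e = 0 := by
      unfold InterCluster VEquiv at hic
      push Not at hic
      obtain ⟨A, hA, h | h⟩ := hic
      · exact absurd ⟨G.dl A, minCut_of_part hst hmax hA, by simp [dl, h]⟩ hnc
      · exact back_flow hst hf hfv hA h.1 h.2
    simp [inc, dl, h1, h2, hz]
  · have hic : G.InterCluster s t lam e := fun h =>
      h1 (hR _ _ (Or.inl (fun A hA => (h A hA).symm)) h2)
    have hc : G.Critical s t e := by
      by_contra h
      exact h1 (hR _ _ (Or.inr ⟨e, hic, Or.inr ⟨h, rfl, rfl⟩⟩) h2)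
    have := critical_flow hst hmax hf hfv hc
    simp [inc, dl, h1, h2, this]
  · simp [inc, dl, h1, h2]

lemma back_closed {R : Finset V} (h0 : G.dl Rᶜ = ∅) {a b : V} (h : G.ReachAvoid ∅ a b)
    (hb : b ∈ R) : a ∈ R := by
  induction h using Relation.ReflTransGen.head_induction_on with
  | refl => exact hb
  | head h1 _ ih =>
    obtain ⟨e, _, rfl, rfl⟩ := h1
    by_contra h
    have : e ∈ G.dl Rᶜ := by simp [dl, h, ih]
    rw [h0] at this
    simp at this

lemma reach_from_s (hst : s ≠ t) (hpath : ∀ v : V, G.ReachAvoid ∅ s v ∧ G.ReachAvoid ∅ v t)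
    (hmax : G.IsMaxFlowValue s t ∅ lam) (hlam : 0 < lam) (v : V) : G.DReach s t lam s v := by
  classical
  set R : Finset V := univ.filter (fun v => G.DReach s t lam s v) with hRd
  have hR : ∀ u v, G.DStep s t lam u v → u ∈ R → v ∈ R := by
    intro u v h hu
    simp only [hRd, Finset.mem_filter, Finset.mem_univ, true_and] at hu ⊢
    exact Relation.ReflTransGen.tail hu h
  have hs : s ∈ R := by
    simp only [hRd, Finset.mem_filter, Finset.mem_univ, true_and]; exact Relation.ReflTransGen.refl
  have h := closed_val hst hmax hR
  by_cases ht : t ∈ R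
  · simp only [hs, ht, if_true, sub_self, mul_zero] at h
    have h0 : G.dl Rᶜ = ∅ := by rw [← Finset.card_eq_zero]; omega
    have := back_closed h0 (hpath v).2 ht
    simpa [hRd] using this
  · simp only [hs, ht, if_true, if_false, sub_zero, mul_one] at h
    omega

lemma reach_to_t (hst : s ≠ t) (hpath : ∀ v : V, G.ReachAvoid ∅ s v ∧ G.ReachAvoid ∅ v t)
    (hmax : G.IsMaxFlowValue s t ∅ lam) (hlam : 0 < lam) (v : V) : G.DReach s t lam v t := by
  classical
  set R : Finset V := univ.filter (fun v => ¬ G.DReach s t lam v t) with hRd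
  have hR : ∀ u v, G.DStep s t lam u v → u ∈ R → v ∈ R := by
    intro u v h hu
    simp only [hRd, Finset.mem_filter, Finset.mem_univ, true_and] at hu ⊢
    exact fun h2 => hu (Relation.ReflTransGen.head h h2)
  have ht : t ∉ R := by
    simp only [hRd, Finset.mem_filter, Finset.mem_univ, true_and, not_not]
    exact Relation.ReflTransGen.refl
  have h := closed_val hst hmax hR
  by_cases hs : s ∈ R
  · simp only [hs, ht, if_true, if_false, sub_zero, mul_one] at h
    omega
  · simp only [hs, ht, if_false, sub_self, mul_zero] at h
    have h0 : G.dl Rᶜ = ∅ := by rw [← Finset.card_eq_zero]; omega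
    by_contra hv
    exact hs (back_closed h0 (hpath v).1 (by simpa [hRd] using hv))

lemma exists_max (hst : s ≠ t) (F : Finset E) : ∃ m : ℤ, G.IsMaxFlowValue s t F m := by
  obtain ⟨m, h1, h2⟩ := Int.exists_greatest_of_bdd
    (P := fun m => ∃ f, G.IsFlow s t f ∧ (∀ e ∈ F, f e = 0) ∧ G.flowValue s f = m)
    ⟨(G.dl {s} \ F).card, by
      rintro z ⟨f, hf, h0, rfl⟩
      exact weak hst hf h0 (by simp) (by simpa using hst.symm)⟩
    ⟨0, fun _ => 0, ⟨by simp, by intro v _ _; simp⟩, by simp, by simp [flowValue]⟩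
  exact ⟨m, h1, fun f hf h0 => h2 _ ⟨f, hf, h0, rfl⟩⟩

/-- The flow drops by `k` iff `E'` lies in one min-cut partition. -/
lemma drop_iff (hst : s ≠ t) (hmax : G.IsMaxFlowValue s t ∅ lam) (E' : Finset E) :
    G.IsMaxFlowValue s t E' ((lam : ℤ) - E'.card) ↔
      ∃ A, G.IsMinCutPartition s t lam A ∧ E' ⊆ G.dl A := by
  constructor
  · intro h
    obtain ⟨A, hs, ht, hc⟩ := mfmc hst h
    have h1 := lam_le hst hmax hs ht
    have h2 := Finset.card_sdiff_add_card_inter (G.dl A) E'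
    have h3 := Finset.card_le_card (Finset.inter_subset_right (s₁ := G.dl A) (s₂ := E'))
    have h4 : G.dl A ∩ E' = E' :=
      Finset.eq_of_subset_of_card_le Finset.inter_subset_right (by omega)
    refine ⟨A, ⟨hs, ht, ?_⟩, Finset.inter_eq_right.1 h4⟩
    rw [h4] at h2
    change (G.dl A).card = lam
    omega
  · rintro ⟨A, hA, hE⟩
    obtain ⟨m, hm⟩ := exists_max (G := G) hst E'
    obtain ⟨B, hs, ht, hc⟩ := mfmc hst hm
    have h1 := lam_le hst hmax hs ht
    have h2 := Finset.card_sdiff_add_card_inter (G.dl B) E'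
    have h3 := Finset.card_le_card (Finset.inter_subset_right (s₁ := G.dl B) (s₂ := E'))
    have h4 := Finset.card_sdiff_add_card_inter (G.dl A) E'
    rw [Finset.inter_eq_right.2 hE] at h4
    have h5 : (G.dl A).card = lam := hA.2.2
    obtain ⟨f, hf, h0, hv⟩ := hm.1
    have h6 := weak hst hf h0 hA.1 hA.2.1
    have : m = (lam : ℤ) - E'.card := by omega
    rw [← this]
    exact hm

end main

end aux

end Digraph'

/-- Assume every vertex of `G` lies on a directed `(s,t)`-path.
Let `E'` be a set of `k` edges of `G`. Then the maximum `(s,t)`-flow value of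
`G − E'` equals `λ − k` iff every edge of `E'` is critical and `E'`, regarded as a
set of edges of the strip graph `D_λ`, is an antichain. -/
theorem stmt15 {V E : Type} [Fintype V] [DecidableEq V] [Fintype E] [DecidableEq E]
    (G : Digraph' V E) (s t : V) (hst : s ≠ t)
    (hpath : ∀ v : V, G.ReachAvoid ∅ s v ∧ G.ReachAvoid ∅ v t)
    (lam : ℕ) (hmax : G.IsMaxFlowValue s t ∅ lam)
    (E' : Finset E) (k : ℕ) (hk : E'.card = k) :
    G.IsMaxFlowValue s t E' ((lam : ℤ) - k) ↔
      (∀ e ∈ E', G.Critical s t e) ∧ G.EdgeAntichain s t lam E' := by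
  classical
  subst hk
  rw [Digraph'.drop_iff hst hmax]
  constructor
  · rintro ⟨A, hA, hE⟩
    have hcr : ∀ e ∈ E', G.Critical s t e := fun e he =>
      ⟨G.dl A, Digraph'.minCut_of_part hst hmax hA, hE he⟩
    refine ⟨hcr, ?_⟩
    rintro e he e' he' (h | ⟨u, v, u', v', h1, h2, _, h3, _⟩)
    · exact h
    · exfalso
      rcases h1 with ⟨_, rfl, rfl⟩ | ⟨h, _⟩
      · rcases h2 with ⟨_, rfl, rfl⟩ | ⟨h, _⟩
        · have h5 := hE he
          have h6 := hE he'
          simp only [Digraph'.dl, Finset.mem_filter, Finset.mem_univ, true_and] at h5 h6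
          exact h5.2 (Digraph'.part_reach hst hmax hA h3 h6.1)
        · exact h (hcr _ he')
      · exact h (hcr _ he)
  · rintro ⟨hcr, hanti⟩
    have hno : ∀ e ∈ E', ∃ A, G.IsMinCutPartition s t lam A ∧ G.src e ∈ A ∧ G.tgt e ∉ A := by
      intro e he
      obtain ⟨A, hA, h⟩ := Digraph'.part_of_critical hst hmax (hcr e he)
      exact ⟨A, hA, by simpa [Digraph'.dl] using h⟩
    set R : Finset V := univ.filter (fun v => G.DReach s t lam t v ∨
      ∃ e ∈ E', G.DReach s t lam (G.tgt e) v) with hRd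
    have hR : ∀ u v, G.DStep s t lam u v → u ∈ R → v ∈ R := by
      intro u v h hu
      simp only [hRd, Finset.mem_filter, Finset.mem_univ, true_and] at hu ⊢
      rcases hu with hu | ⟨e, he, hu⟩
      · exact Or.inl (Relation.ReflTransGen.tail hu h)
      · exact Or.inr ⟨e, he, Relation.ReflTransGen.tail hu h⟩
    have hs : s ∉ R := by
      simp only [hRd, Finset.mem_filter, Finset.mem_univ, true_and]
      rintro (h | ⟨e, he, h⟩)
      · obtain ⟨A, h1, h2, h3⟩ := Digraph'.mfmc hst hmax
        simp only [Finset.sdiff_empty, Nat.cast_inj] at h3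
        exact h2 (Digraph'.part_reach hst hmax ⟨h1, h2, h3⟩ h h1)
      · obtain ⟨A, hA, h1, h2⟩ := hno e he
        exact h2 (Digraph'.part_reach hst hmax hA h hA.1)
    have ht : t ∈ R := by
      simp only [hRd, Finset.mem_filter, Finset.mem_univ, true_and]
      exact Or.inl Relation.ReflTransGen.refl
    have hval := Digraph'.closed_val hst hmax hR
    simp only [hs, ht, if_true, if_false] at hval
    refine ⟨Rᶜ, ⟨by simpa using hs, by simpa using ht, ?_⟩, ?_⟩
    · change (G.dl Rᶜ).card = lam
      omega
    · intro e' he'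
      have htg : G.tgt e' ∈ R := by
        simp only [hRd, Finset.mem_filter, Finset.mem_univ, true_and]
        exact Or.inr ⟨e', he', Relation.ReflTransGen.refl⟩
      obtain ⟨A, hA, h1, h2⟩ := hno e' he'
      have hsr : G.src e' ∉ R := by
        simp only [hRd, Finset.mem_filter, Finset.mem_univ, true_and]
        rintro (h | ⟨e, he, h⟩)
        · exact hA.2.1 (Digraph'.part_reach hst hmax hA h h1)
        · have hlam : 0 < lam := by
            rw [← hA.2.2]
            exact Finset.card_pos.2 ⟨e', by simp [h1, h2]⟩
          have heq : e = e' := hanti e he e' he' (Or.inr ⟨_, _, _, _,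
            Or.inl ⟨hcr e he, rfl, rfl⟩, Or.inl ⟨hcr e' he', rfl, rfl⟩,
            Digraph'.reach_from_s hst hpath hmax hlam _, h,
            Digraph'.reach_to_t hst hpath hmax hlam _⟩)
          subst heq
          exact h2 (Digraph'.part_reach hst hmax hA h h1)
      simp [Digraph'.dl, htg, hsr]
end
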